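/- Let m be an odd positive integer, let δ be a real number with 0 < δ < 1/3 and H(3δ/2) < 1/2, and let ℓ_m be the minimal degree of the irreducible factors in (Z/2)[X] of (X^m − 1)/(X − 1). Then the number of pairs (a(X), b(X)) ∈ J_m × J_m for which there exists c(X) ∈ J_m with 1 ≤ wt_H(c(X)a(X)) + 2·wt_H(c(X)b(X)) ≤ 3mδ (equivalently, C_{a,b} contains a nonzero codeword of weight at most 3mδ) is at most 2^{2(m−1)} · ∑_{j=ℓ_m}^{m−1} 2^{−2j(1/2 − H(3δ/2) − (log₂ m)/ℓ_m)}. -/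

import Mathlib

open Polynomial

noncomputable section

/-- The polynomial `X^m - 1` over `Z/2`. -/
def fm (m : ℕ) : Polynomial (ZMod 2) := X ^ m - 1

/-- The polynomial `X^m - 1` over `Z/4`. -/
def fm4 (m : ℕ) : Polynomial (ZMod 4) := X ^ m - 1

/-- `R_m = (Z/2)[X]/⟨X^m - 1⟩`. -/
abbrev R2 (m : ℕ) : Type := Polynomial (ZMod 2) ⧸ Ideal.span {fm m}

/-- `R'_m = (Z/4)[X]/⟨X^m - 1⟩`. -/
abbrev R4 (m : ℕ) : Type := Polynomial (ZMod 4) ⧸ Ideal.span {fm4 m}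

def mk2 (m : ℕ) : Polynomial (ZMod 2) →+* R2 m := Ideal.Quotient.mk _

def mk4 (m : ℕ) : Polynomial (ZMod 4) →+* R4 m := Ideal.Quotient.mk _

/-- The canonical representative (of degree `< m`) of an element of `R2 m`. -/
def rep2 (m : ℕ) (r : R2 m) : Polynomial (ZMod 2) :=
  (Function.surjInv (Ideal.Quotient.mk_surjective (I := Ideal.span {fm m})) r) %ₘ fm m

/-- The canonical representative (of degree `< m`) of an element of `R4 m`. -/
def rep4 (m : ℕ) (r : R4 m) : Polynomial (ZMod 4) :=
  (Function.surjInv (Ideal.Quotient.mk_surjective (I := Ideal.span {fm4 m})) r) %ₘ fm4 m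

/-- Coefficientwise doubling map `(Z/2)[X] → (Z/4)[X]`, `a ↦ 2a` on each coefficient. -/
def polyDbl (p : Polynomial (ZMod 2)) : Polynomial (ZMod 4) :=
  ∑ i ∈ p.support, Polynomial.C (2 * ((p.coeff i).val : ZMod 4)) * X ^ i

/-- The additive embedding `R_m → R'_m`, `f ↦ 2f`. -/
def iota (m : ℕ) (r : R2 m) : R4 m := mk4 m (polyDbl (rep2 m r))

/-- Hamming weight of an element of `R_m` (of its coefficient vector). -/
def wt2 (m : ℕ) (r : R2 m) : ℕ := (rep2 m r).support.card

/-- Lee weight of an element of `Z/4`. -/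
def lee (x : ZMod 4) : ℕ := min x.val (4 - x.val)

/-- Lee weight of an element of `R'_m` (of its coefficient vector). -/
def wtLee (m : ℕ) (r : R4 m) : ℕ := ∑ i ∈ (rep4 m r).support, lee ((rep4 m r).coeff i)

/-- The augmentation ideal `J_m = ⟨X - 1⟩` of `R_m`. -/
def Jm (m : ℕ) : Ideal (R2 m) := Ideal.span {mk2 m (X - 1)}

/-- The `Z2Z4`-additive cyclic code `C_{a,b} = {(f·a, 2(f·b)) : f ∈ R_m}`. -/
def Cab (m : ℕ) (a b : R2 m) : Set (R2 m × R4 m) :=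
  {w | ∃ f : R2 m, w = (f * a, iota m (f * b))}

/-- Dimension of `C_{a,b}` as a vector space over `Z/2`, i.e. `log₂ |C_{a,b}|`. -/
def dimCab (m : ℕ) (a b : R2 m) : ℕ := Nat.log 2 (Nat.card (Cab m a b))

/-- `(X^m - 1)/(X - 1) = X^{m-1} + ⋯ + X + 1` over `Z/2`. -/
def geomPoly (m : ℕ) : Polynomial (ZMod 2) := ∑ i ∈ Finset.range m, X ^ i

/-- `ℓ_m`: minimal degree of the irreducible factors of `(X^m-1)/(X-1)` in `(Z/2)[X]`. -/
def ell (m : ℕ) : ℕ :=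
  sInf {d | ∃ p : Polynomial (ZMod 2), Irreducible p ∧ p ∣ geomPoly m ∧ p.natDegree = d}

/-- The binary entropy function `H(x) = -x·log₂x - (1-x)·log₂(1-x)`. -/
def Hent (x : ℝ) : ℝ := -(x * Real.logb 2 x) - (1 - x) * Real.logb 2 (1 - x)

lemma fm_monic (m : ℕ) (hm : 0 < m) : (fm m).Monic := by
  unfold fm
  exact monic_X_pow_sub_C (1 : ZMod 2) hm.ne'

lemma fm_degree (m : ℕ) (hm : 0 < m) : (fm m).degree = m := by
  unfold fm
  exact degree_X_pow_sub_C hm (1 : ZMod 2)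

lemma mk2_eq_iff (m : ℕ) (p q : Polynomial (ZMod 2)) : mk2 m p = mk2 m q ↔ fm m ∣ p - q := by
  unfold mk2
  rw [Ideal.Quotient.eq, Ideal.mem_span_singleton]

lemma mk2_eq_zero_iff (m : ℕ) (p : Polynomial (ZMod 2)) : mk2 m p = 0 ↔ fm m ∣ p := by
  have := mk2_eq_iff m p 0
  simpa using this

lemma mk2_surj (m : ℕ) : Function.Surjective (mk2 m) := Ideal.Quotient.mk_surjective

lemma mk2_rep2 (m : ℕ) (r : R2 m) : mk2 m (rep2 m r) = r := by
  unfold rep2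
  set q := Function.surjInv (Ideal.Quotient.mk_surjective (I := Ideal.span {fm m})) r with hq
  have h1 : mk2 m q = r := Function.surjInv_eq _ r
  have h2 : mk2 m (q %ₘ fm m) = mk2 m q := by
    rw [mk2_eq_iff]
    refine ⟨-(q /ₘ fm m), ?_⟩
    have := modByMonic_add_div q (fm m)
    linear_combination this
  rw [h2, h1]

lemma rep2_degree (m : ℕ) (hm : 0 < m) (r : R2 m) : (rep2 m r).degree < m := by
  unfold rep2
  rw [← fm_degree m hm]
  exact degree_modByMonic_lt _ (fm_monic m hm)

lemma rep2_unique (m : ℕ) (hm : 0 < m) (r : R2 m) (p : Polynomial (ZMod 2))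
    (hp : p.degree < m) (h : mk2 m p = r) : rep2 m r = p := by
  have h1 : fm m ∣ rep2 m r - p := by
    rw [← mk2_eq_iff, mk2_rep2, h]
  have h2 : (rep2 m r - p).degree < (fm m).degree := by
    rw [fm_degree m hm]
    exact (degree_sub_le _ _).trans_lt (max_lt (rep2_degree m hm r) hp)
  exact sub_eq_zero.1 (eq_zero_of_dvd_of_degree_lt h1 h2)

lemma rep2_inj (m : ℕ) : Function.Injective (rep2 m) := fun a b h => by
  rw [← mk2_rep2 m a, ← mk2_rep2 m b, h]

lemma rep2_zero (m : ℕ) (hm : 0 < m) : rep2 m 0 = 0 :=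
  rep2_unique m hm 0 0 (by simp) (map_zero _)

lemma wt2_eq_zero (m : ℕ) (r : R2 m) (h : wt2 m r ≠ 0) (hm : 0 < m) : r ≠ 0 := by
  rintro rfl
  apply h
  simp [wt2, rep2_zero m hm]

instance finDegLT (n : ℕ) : Finite (degreeLT (ZMod 2) n) :=
  Finite.of_equiv _ (degreeLTEquiv (ZMod 2) n).toEquiv.symm

lemma card_degLT (n : ℕ) : Nat.card (degreeLT (ZMod 2) n) = 2 ^ n := by
  rw [Nat.card_congr (degreeLTEquiv (ZMod 2) n).toEquiv]
  simp

lemma finite_R2 (m : ℕ) (hm : 0 < m) : Finite (R2 m) :=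
  Finite.of_injective (β := degreeLT (ZMod 2) m)
    (fun r => ⟨rep2 m r, mem_degreeLT.2 (rep2_degree m hm r)⟩)
    (fun a b h => rep2_inj m (by simpa using h))

lemma fm_eq (m : ℕ) : fm m = (X - 1) * geomPoly m := by
  unfold fm geomPoly
  rw [mul_comm, geom_sum_mul]

lemma Jm_eval (m : ℕ) (p : Polynomial (ZMod 2)) (h : mk2 m p ∈ Jm m) : (X - 1) ∣ p := by
  unfold Jm at h
  rw [Ideal.mem_span_singleton] at h
  obtain ⟨c, hc⟩ := h
  obtain ⟨q, rfl⟩ := mk2_surj m c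
  rw [← map_mul, mk2_eq_iff] at hc
  have h1 : (X - 1) ∣ p - (X - 1) * q := (Dvd.intro _ (fm_eq m).symm).trans hc
  have h2 := dvd_add h1 (Dvd.intro q rfl)
  simpa using h2

lemma card_Jm (m : ℕ) (hm : 0 < m) : Nat.card (Jm m) ≤ 2 ^ (m - 1) := by
  rw [← card_degLT]
  have key : ∀ r : Jm m, ∃ q : Polynomial (ZMod 2), rep2 m r = (X - 1) * q := fun r =>
    Jm_eval m _ (by rw [mk2_rep2]; exact r.2)
  choose q hq using key
  refine Nat.card_le_card_of_injective
    (fun r : Jm m => (⟨q r, ?_⟩ : degreeLT (ZMod 2) (m - 1))) ?_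
  · rw [mem_degreeLT]
    have h1 := rep2_degree m hm r
    rw [hq r] at h1
    have h2 : ((X : Polynomial (ZMod 2)) - 1).degree = 1 := degree_X_sub_C (1 : ZMod 2)
    rw [degree_mul, h2] at h1
    by_cases h0 : q r = 0
    · rw [h0]; simp
    · rw [degree_eq_natDegree h0] at h1 ⊢
      have h3 : 1 + (q r).natDegree < m := by exact_mod_cast h1
      have : (q r).natDegree < m - 1 := by omega
      exact_mod_cast this
  · intro a b h
    apply Subtype.ext
    apply rep2_inj
    rw [hq a, hq b]
    have : q a = q b := by simpa using h
    rw [this]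

lemma mk2_X_pow (m : ℕ) : (mk2 m X) ^ m = 1 := by
  rw [← map_pow, ← map_one (mk2 m), mk2_eq_iff]
  exact dvd_rfl

lemma frob (m : ℕ) (hm : Odd m) : ∃ n : ℕ, ∀ r : R2 m, r ^ (n + 2) = r := by
  have hm0 : 0 < m := hm.pos
  have hpos : 0 < Nat.totient m := Nat.totient_pos.2 hm0
  have h2 : 2 ^ 1 ≤ 2 ^ Nat.totient m := Nat.pow_le_pow_right (by norm_num) hpos
  refine ⟨2 ^ Nat.totient m - 2, fun r => ?_⟩
  have he : 2 ^ Nat.totient m - 2 + 2 = 2 ^ Nat.totient m := by omega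
  rw [he]
  have hmod : 2 ^ Nat.totient m ≡ 1 [MOD m] :=
    Nat.ModEq.pow_totient (Nat.coprime_two_left.2 hm)
  have hx : (mk2 m X) ^ (2 ^ Nat.totient m) = mk2 m X := by
    have h3 : m ∣ 2 ^ Nat.totient m - 1 :=
      (Nat.modEq_iff_dvd' (Nat.one_le_two_pow)).1 hmod.symm
    obtain ⟨k, hk⟩ := h3
    have h4 : 2 ^ Nat.totient m = m * k + 1 := by omega
    rw [h4, pow_succ, pow_mul, mk2_X_pow, one_pow, one_mul]
  obtain ⟨p, rfl⟩ := mk2_surj m r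
  have hp : p ^ (2 ^ Nat.totient m) = p.comp (X ^ (2 ^ Nat.totient m)) := by
    have : ∀ s : ℕ, p ^ (2 ^ s) = expand (ZMod 2) (2 ^ s) p := by
      intro s
      induction s with
      | zero => simp
      | succ s ih => rw [pow_succ, pow_mul, ih, ← ZMod.expand_card, expand_expand, mul_comm]
    rw [this, expand_eq_comp_X_pow]
  have hc : ∀ q : Polynomial (ZMod 2), mk2 m (p.comp q) = p.eval₂ ((mk2 m).comp C) (mk2 m q) :=
    fun q => hom_eval₂ p C (mk2 m) q
  rw [← map_pow, hp, hc, map_pow, hx, ← hc, comp_X]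

lemma exists_idem_gen (m : ℕ) (hm : Odd m) (I : Ideal (R2 m)) :
    ∃ e ∈ I, ∀ x ∈ I, e * x = x := by
  obtain ⟨n, hn⟩ := frob m hm
  have hI : IsIdempotentElem I := by
    refine le_antisymm Ideal.mul_le_right fun x hx => ?_
    have : x = x * (x ^ n * x) := by
      conv_lhs => rw [← hn x]
      ring
    rw [this]
    exact Ideal.mul_mem_mul hx (I.mul_mem_left _ hx)
  obtain ⟨e, he, hIe⟩ := (Ideal.isIdempotentElem_iff_of_fg I (IsNoetherian.noetherian I)).1 hI
  refine ⟨e, by rw [hIe]; exact Ideal.mem_span_singleton_self e, fun x hx => ?_⟩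
  rw [hIe] at hx
  obtain ⟨c, rfl⟩ := Ideal.mem_span_singleton'.1 hx
  rw [mul_left_comm, he.eq]

/-- Cyclic coordinates of an element of `R2 m`. -/
def cf (m : ℕ) (r : R2 m) (k : ZMod m) : ZMod 2 := (rep2 m r).coeff k.val

lemma cf_shift (m : ℕ) [NeZero m] (r : R2 m) (k : ZMod m) :
    cf m (mk2 m X * r) k = cf m r (k - 1) := by
  have hm : 0 < m := Nat.pos_of_ne_zero (NeZero.ne m)
  set p := rep2 m r with hp
  have hpd := rep2_degree m hm r
  rw [← hp] at hpd
  have hcoef : ∀ n, m ≤ n → p.coeff n = 0 := fun n hn =>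
    coeff_eq_zero_of_degree_lt (hpd.trans_le (by exact_mod_cast hn))
  set q := X * p - C (p.coeff (m - 1)) * (X ^ m - 1) with hq
  have hqc0 : q.coeff 0 = p.coeff (m - 1) := by
    simp [hq, hm.ne, coeff_X_pow, coeff_one]
  have hqc : ∀ n, 0 < n → n < m → q.coeff n = p.coeff (n - 1) := by
    intro n h0 h1
    obtain ⟨n, rfl⟩ : ∃ n', n = n' + 1 := ⟨n - 1, by omega⟩
    simp [hq, coeff_X_pow, coeff_one, h1.ne]
  have hqd : q.degree < m := by
    rw [degree_lt_iff_coeff_zero]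
    intro n hn
    obtain ⟨n, rfl⟩ : ∃ n', n = n' + 1 := ⟨n - 1, by omega⟩
    by_cases h : n + 1 = m
    · have : m - 1 = n := by omega
      rw [hq, this, ← h]
      simp [coeff_X_pow, coeff_one]
    · simp [hq, coeff_X_pow, coeff_one, h, hcoef n (by omega)]
  have hrep : rep2 m (mk2 m X * r) = q := by
    refine rep2_unique m hm _ q hqd ?_
    have : mk2 m (X ^ m - 1) = 0 := (mk2_eq_zero_iff m _).2 dvd_rfl
    rw [hq, map_sub, map_mul, map_mul, this, mul_zero, sub_zero, hp, mk2_rep2]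
  unfold cf
  rw [hrep, ← hp]
  by_cases hk : k = 0
  · subst hk
    rw [ZMod.val_zero, hqc0]
    congr 1
    rw [zero_sub, ZMod.neg_val]
    split_ifs with h1
    · have : m = 1 := by
        have h2 : ((1 : ℕ) : ZMod m) = 0 := by simpa using h1
        rw [ZMod.natCast_eq_zero_iff] at h2
        simpa using h2
      omega
    · have hm2 : 1 < m := by
        by_contra h
        have : m = 1 := by omega
        subst this
        exact h1 (Subsingleton.elim _ _)
      rw [ZMod.val_one'' (by omega)]
  · have hv : 0 < k.val := Nat.pos_of_ne_zero (by simpa [ZMod.val_eq_zero] using hk)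
    rw [hqc _ hv (ZMod.val_lt k)]
    congr 1
    have h1 : k - 1 = ((k.val - 1 : ℕ) : ZMod m) := by
      rw [Nat.cast_sub hv]; simp
    rw [h1, ZMod.val_natCast, Nat.mod_eq_of_lt]
    have := ZMod.val_lt k
    omega

lemma cf_shift_pow (m : ℕ) [NeZero m] (r : R2 m) (t : ℕ) (k : ZMod m) :
    cf m (mk2 m X ^ t * r) k = cf m r (k - t) := by
  induction t generalizing k with
  | zero => simp
  | succ t ih =>
    rw [pow_succ', mul_assoc, cf_shift, ih]
    push_cast
    congr 1
    ring

lemma wt2_eq (m : ℕ) [NeZero m] (r : R2 m) :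
    wt2 m r = ∑ k : ZMod m, if cf m r k ≠ 0 then 1 else 0 := by
  have hm : 0 < m := Nat.pos_of_ne_zero (NeZero.ne m)
  rw [← Finset.card_filter]
  unfold wt2
  symm
  refine Finset.card_bij (fun k _ => k.val) ?_ ?_ ?_
  · intro k hk
    rw [Finset.mem_filter] at hk
    exact mem_support_iff.2 hk.2
  · intro a _ b _ h
    exact ZMod.val_injective m h
  · intro n hn
    have h1 : n < m := by
      by_contra h
      exact (mem_support_iff.1 hn) (coeff_eq_zero_of_degree_lt
        ((rep2_degree m hm r).trans_le (by exact_mod_cast not_lt.1 h)))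
    refine ⟨(n : ZMod m), ?_, ?_⟩
    · rw [Finset.mem_filter]
      refine ⟨Finset.mem_univ _, ?_⟩
      rw [cf, ZMod.val_natCast, Nat.mod_eq_of_lt h1]
      exact mem_support_iff.1 hn
    · rw [ZMod.val_natCast, Nat.mod_eq_of_lt h1]

/-- The part of the support of (the shift by `t` of) `r` in the top `j` coordinates. -/
def win (m j t : ℕ) (r : R2 m) : Finset ℕ :=
  (Finset.Ico (m - j) m).filter fun i => (rep2 m (mk2 m X ^ t * r)).coeff i ≠ 0

lemma sum_win (m : ℕ) (hm : 0 < m) (j : ℕ) (hj : j ≤ m) (r : R2 m) :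
    ∑ t ∈ Finset.range m, (win m j t r).card = j * wt2 m r := by
  have : NeZero m := ⟨hm.ne'⟩
  unfold win
  simp_rw [Finset.card_filter]
  rw [Finset.sum_comm]
  have : ∀ i ∈ Finset.Ico (m - j) m, (∑ t ∈ Finset.range m,
      if (rep2 m (mk2 m X ^ t * r)).coeff i ≠ 0 then 1 else 0) = wt2 m r := by
    intro i hi
    rw [Finset.mem_Ico] at hi
    have h1 : ∀ t : ℕ, (rep2 m (mk2 m X ^ t * r)).coeff i = cf m r ((i : ZMod m) - t) := by
      intro t
      rw [← cf_shift_pow, cf, ZMod.val_natCast, Nat.mod_eq_of_lt hi.2]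
    simp_rw [h1]
    rw [wt2_eq, ← Equiv.sum_comp (Equiv.subLeft (i : ZMod m))]
    refine Finset.sum_bij (fun t _ => (t : ZMod m)) (by simp) ?_ ?_ ?_
    · intro a ha b hb h
      rw [Finset.mem_range] at ha hb
      have := congrArg ZMod.val h
      rwa [ZMod.val_natCast, ZMod.val_natCast, Nat.mod_eq_of_lt ha, Nat.mod_eq_of_lt hb] at this
    · intro b _
      exact ⟨b.val, Finset.mem_range.2 (ZMod.val_lt b), by simp⟩
    · intro t _
      simp
  rw [Finset.sum_congr rfl this]
  simp only [Finset.sum_const, Nat.card_Ico, smul_eq_mul]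
  congr 1
  omega

/-- Ideal with generator `g`: the top window determines the element. -/
lemma win_inj (m : ℕ) (hm : 0 < m) (j t : ℕ) (g : Polynomial (ZMod 2))
    (hg : g ∣ fm m) (hgd : g.natDegree = m - j) (u v : R2 m)
    (hu : u ∈ Ideal.span {mk2 m g}) (hv : v ∈ Ideal.span {mk2 m g})
    (h : win m j t u = win m j t v) : u = v := by
  have hdvd : ∀ w ∈ Ideal.span {mk2 m g}, g ∣ rep2 m (mk2 m X ^ t * w) := by
    intro w hw
    have hw' := Ideal.mul_mem_left _ (mk2 m X ^ t) hw
    obtain ⟨c, hc⟩ := Ideal.mem_span_singleton'.1 hw'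
    obtain ⟨q, rfl⟩ := mk2_surj m c
    have h1 : mk2 m (rep2 m (mk2 m X ^ t * w)) = mk2 m (q * g) := by
      rw [mk2_rep2, ← hc, map_mul]
    rw [mk2_eq_iff] at h1
    have h2 := dvd_add (hg.trans h1) (Dvd.intro_left q rfl)
    simpa using h2
  have hg0 : g ≠ 0 := fun h0 => (fm_monic m hm).ne_zero (by rw [h0] at hg; exact zero_dvd_iff.1 hg)
  set p := rep2 m (mk2 m X ^ t * u) with hp
  set q := rep2 m (mk2 m X ^ t * v) with hq
  have hz : ∀ x y : ZMod 2, (x ≠ 0 ↔ y ≠ 0) → x = y := by decide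
  have hpq : p - q = 0 := by
    refine eq_zero_of_dvd_of_degree_lt (dvd_sub (hdvd u hu) (hdvd v hv)) ?_
    rw [degree_eq_natDegree hg0, hgd, degree_lt_iff_coeff_zero]
    intro n hn
    rw [coeff_sub, sub_eq_zero]
    by_cases hnm : n < m
    · have h1 := Finset.ext_iff.1 h n
      simp only [win, Finset.mem_filter, Finset.mem_Ico] at h1
      apply hz
      constructor
      · intro h2
        exact (h1.1 ⟨⟨hn, hnm⟩, h2⟩).2
      · intro h2
        exact (h1.2 ⟨⟨hn, hnm⟩, h2⟩).2
    · have hle : (m : WithBot ℕ) ≤ n := by exact_mod_cast not_lt.1 hnm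
      rw [coeff_eq_zero_of_degree_lt ((rep2_degree m hm _).trans_le hle),
        coeff_eq_zero_of_degree_lt ((rep2_degree m hm _).trans_le hle)]
  have h3 : mk2 m X ^ t * u = mk2 m X ^ t * v := rep2_inj m (sub_eq_zero.1 hpq)
  have hunit : IsUnit (mk2 m X ^ t) :=
    (IsUnit.of_pow_eq_one (mk2_X_pow m) hm.ne').pow t
  exact hunit.mul_left_cancel h3

lemma sum_win_pow_le (m : ℕ) (hm : 0 < m) (j t : ℕ) (hj : j ≤ m) (g : Polynomial (ZMod 2))
    (hg : g ∣ fm m) (hgd : g.natDegree = m - j) (S : Finset (R2 m × R2 m))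
    (hS : ∀ s ∈ S, s.1 ∈ Ideal.span {mk2 m g} ∧ s.2 ∈ Ideal.span {mk2 m g})
    (l : ℝ) (hl : 0 ≤ l) :
    ∑ s ∈ S, l ^ ((win m j t s.1).card + (win m j t s.2).card) ≤ (1 + l) ^ (2 * j) := by
  classical
  set W := Finset.Ico (m - j) m with hW
  have hWc : W.card = j := by simp [hW]; omega
  have h1 : ∑ A ∈ W.powerset, l ^ A.card = (1 + l) ^ j := by
    have := Finset.sum_pow_mul_eq_add_pow l 1 W
    simpa [hWc, add_comm] using this
  have h2 : ∑ A ∈ W.powerset ×ˢ W.powerset, l ^ (A.1.card + A.2.card) = (1 + l) ^ (2 * j) := by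
    rw [Finset.sum_product, two_mul, pow_add, ← h1, Finset.sum_mul_sum]
    simp_rw [pow_add]
  rw [← h2]
  have hinj : Set.InjOn (fun s : R2 m × R2 m => (win m j t s.1, win m j t s.2)) S := by
    intro a ha b hb h
    simp only [Prod.mk.injEq] at h
    exact Prod.ext
      (win_inj m hm j t g hg hgd _ _ (hS a ha).1 (hS b hb).1 h.1)
      (win_inj m hm j t g hg hgd _ _ (hS a ha).2 (hS b hb).2 h.2)
  rw [← Finset.sum_image (f := fun A : Finset ℕ × Finset ℕ => l ^ (A.1.card + A.2.card)) hinj]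
  refine Finset.sum_le_sum_of_subset_of_nonneg ?_ (fun _ _ _ => by positivity)
  intro A hA
  obtain ⟨s, _, rfl⟩ := Finset.mem_image.1 hA
  rw [Finset.mem_product]
  exact ⟨Finset.mem_powerset.2 (Finset.filter_subset _ _),
    Finset.mem_powerset.2 (Finset.filter_subset _ _)⟩

lemma avg_pow (m : ℕ) (n : ℕ → ℕ) (l a : ℝ) (hl0 : 0 < l) (hl1 : l ≤ 1)
    (h : ((∑ t ∈ Finset.range m, n t : ℕ) : ℝ) ≤ m * a) :
    m * l ^ a ≤ ∑ t ∈ Finset.range m, l ^ n t := by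
  have hlog : Real.log l ≤ 0 := Real.log_nonpos hl0.le hl1
  have h1 : ∀ t ∈ Finset.range m, l ^ a * (1 + Real.log l * (n t - a)) ≤ l ^ n t := by
    intro t _
    rw [← Real.rpow_natCast l (n t), Real.rpow_def_of_pos hl0, Real.rpow_def_of_pos hl0]
    have h2 : Real.exp (Real.log l * n t)
        = Real.exp (Real.log l * a) * Real.exp (Real.log l * (n t - a)) := by
      rw [← Real.exp_add]; congr 1; ring
    rw [h2]
    gcongr
    linarith [Real.add_one_le_exp (Real.log l * (n t - a))]
  refine le_trans ?_ (Finset.sum_le_sum h1)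
  rw [← Finset.mul_sum, Finset.sum_add_distrib, ← Finset.mul_sum, Finset.sum_sub_distrib]
  simp only [Finset.sum_const, Finset.card_range, nsmul_eq_mul, mul_one]
  push_cast at h
  have h3 : 0 ≤ l ^ a := Real.rpow_nonneg hl0.le a
  have h4 : 0 ≤ Real.log l * (∑ t ∈ Finset.range m, (n t : ℝ) - m * a) :=
    mul_nonneg_of_nonpos_of_nonpos hlog (by linarith)
  nlinarith

lemma S_bound (m : ℕ) (hm : 0 < m) (j : ℕ) (hj : j ≤ m) (g : Polynomial (ZMod 2))
    (hg : g ∣ fm m) (hgd : g.natDegree = m - j) (S : Finset (R2 m × R2 m))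
    (p : ℝ) (hp0 : 0 < p) (hp1 : p < 1 / 2)
    (hS : ∀ s ∈ S, s.1 ∈ Ideal.span {mk2 m g} ∧ s.2 ∈ Ideal.span {mk2 m g})
    (hw : ∀ s ∈ S, ((wt2 m s.1 + wt2 m s.2 : ℕ) : ℝ) ≤ 2 * m * p) :
    (S.card : ℝ) ≤ (2 : ℝ) ^ (2 * j * Hent p) := by
  set l := p / (1 - p) with hl
  have hq : 0 < 1 - p := by linarith
  have hl0 : 0 < l := by positivity
  have hl1 : l ≤ 1 := by rw [hl, div_le_one hq]; linarith
  have hmr : (0 : ℝ) < m := by exact_mod_cast hm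
  have h1 : ∀ s ∈ S, m * l ^ (2 * j * p) ≤
      ∑ t ∈ Finset.range m, l ^ ((win m j t s.1).card + (win m j t s.2).card) := by
    intro s hs
    apply avg_pow m _ l _ hl0 hl1
    rw [Finset.sum_add_distrib, sum_win m hm j hj, sum_win m hm j hj, ← mul_add]
    rw [Nat.cast_mul]
    have := mul_le_mul_of_nonneg_left (hw s hs) (Nat.cast_nonneg (α := ℝ) j)
    calc _ ≤ _ := this
      _ = _ := by ring
  have h2 : S.card * (m * l ^ (2 * j * p)) ≤ m * (1 + l) ^ (2 * j) := by
    calc S.card * (m * l ^ (2 * j * p)) = ∑ s ∈ S, m * l ^ (2 * j * p) := by simp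
      _ ≤ _ := Finset.sum_le_sum h1
      _ = ∑ t ∈ Finset.range m, ∑ s ∈ S, l ^ ((win m j t s.1).card + (win m j t s.2).card) :=
          Finset.sum_comm
      _ ≤ ∑ t ∈ Finset.range m, (1 + l) ^ (2 * j) :=
          Finset.sum_le_sum fun t _ => sum_win_pow_le m hm j t hj g hg hgd S hS l hl0.le
      _ = _ := by simp
  have h3 : S.card * l ^ (2 * j * p) ≤ (1 + l) ^ (2 * j) := by
    have : m * (S.card * l ^ (2 * j * p)) ≤ m * (1 + l) ^ (2 * j) := by linarith
    exact le_of_mul_le_mul_left this hmr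
  have h4 : (1 + l) ^ (2 * j) = (2 : ℝ) ^ (2 * j * Hent p) * l ^ (2 * j * p) := by
    have h5 : 1 + l = (1 - p)⁻¹ := by rw [hl]; field_simp; ring
    rw [← Real.rpow_natCast, Real.rpow_def_of_pos (by positivity), Real.rpow_def_of_pos (by norm_num),
      Real.rpow_def_of_pos hl0, ← Real.exp_add, h5, hl, Real.log_inv,
      Real.log_div hp0.ne' hq.ne', Hent, Real.logb, Real.logb]
    congr 1
    have : Real.log 2 ≠ 0 := (Real.log_pos (by norm_num)).ne'
    push_cast
    field_simp
    ring
  rw [h4] at h3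
  exact le_of_mul_le_mul_right h3 (Real.rpow_pos_of_pos hl0 _)

lemma B_bound (m : ℕ) (hm : 0 < m) (I : Ideal (R2 m)) (hIJ : I ≤ Jm m) (e : R2 m) (he : e ∈ I)
    (hI : ∀ x ∈ I, e * x = x) (u v : R2 m) (B : Set (R2 m × R2 m))
    (hB : ∀ p ∈ B, p.1 ∈ Jm m ∧ p.2 ∈ Jm m ∧ ∃ d ∈ I, e * p.1 = d * u ∧ e * p.2 = d * v) :
    Nat.card B * Nat.card I ≤ Nat.card (Jm m) * Nat.card (Jm m) := by
  have := finite_R2 m hm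
  rw [← Nat.card_prod, ← Nat.card_prod]
  choose d hd using fun p : B => (hB p p.2).2.2
  refine Nat.card_le_card_of_injective
    (fun x : B × I => ((⟨x.1.1.1 - e * x.1.1.1 + d x.1, ?_⟩, ⟨x.1.1.2 - e * x.1.1.2 + x.2, ?_⟩) :
      Jm m × Jm m)) ?_
  · exact add_mem (sub_mem (hB _ x.1.2).1 (Ideal.mul_mem_left _ _ (hB _ x.1.2).1))
      (hIJ (hd x.1).1)
  · exact add_mem (sub_mem (hB _ x.1.2).2.1 (Ideal.mul_mem_left _ _ (hB _ x.1.2).2.1))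
      (hIJ x.2.2)
  · rintro ⟨p, i⟩ ⟨q, k⟩ h
    simp only [Prod.mk.injEq, Subtype.mk.injEq] at h
    obtain ⟨h1, h2⟩ := h
    have hee := hI e he
    have hdd : d p = d q := by
      have := congrArg (e * ·) h1
      simp only [mul_add, mul_sub, ← mul_assoc, hee, sub_self, zero_add] at this
      rwa [hI _ (hd p).1, hI _ (hd q).1] at this
    have hik : (i : R2 m) = k := by
      have := congrArg (e * ·) h2
      simp only [mul_add, mul_sub, ← mul_assoc, hee, sub_self, zero_add] at this
      rwa [hI _ i.2, hI _ k.2] at this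
    have h3 : p.1.1 = q.1.1 := by
      rw [(hd p).2.1, (hd q).2.1, hdd] at h1
      simpa using h1
    have h4 : p.1.2 = q.1.2 := by
      rw [(hd p).2.2, (hd q).2.2, hdd, hik] at h2
      simpa using h2
    exact Prod.ext (Subtype.ext (Prod.ext h3 h4)) (Subtype.ext hik)

lemma card_I (m : ℕ) (hm : 0 < m) (g h : Polynomial (ZMod 2)) (hgh : fm m = g * h) :
    2 ^ h.natDegree ≤ Nat.card (Ideal.span {mk2 m g}) := by
  have := finite_R2 m hm
  have hne : g * h ≠ 0 := by rw [← hgh]; exact (fm_monic m hm).ne_zero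
  rw [← card_degLT]
  refine Nat.card_le_card_of_injective
    (fun f : degreeLT (ZMod 2) h.natDegree => (⟨mk2 m (f.1 * g), ?_⟩ : Ideal.span {mk2 m g})) ?_
  · rw [map_mul]
    exact Ideal.mul_mem_left _ _ (Ideal.mem_span_singleton_self _)
  · intro a b hab
    simp only [Subtype.mk.injEq] at hab
    rw [mk2_eq_iff, ← sub_mul, hgh, mul_comm g h] at hab
    have h1 : h ∣ a.1 - b.1 := (mul_dvd_mul_iff_right (left_ne_zero_of_mul hne)).1 hab
    have h2 : (a.1 - b.1).degree < h.degree := by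
      rw [degree_eq_natDegree (right_ne_zero_of_mul hne)]
      exact mem_degreeLT.1 (sub_mem a.2 b.2)
    exact Subtype.ext (sub_eq_zero.1 (eq_zero_of_dvd_of_degree_lt h1 h2))

lemma monic_of_ne_zero2 (p : Polynomial (ZMod 2)) (hp : p ≠ 0) : p.Monic := by
  have : ∀ x : ZMod 2, x ≠ 0 → x = 1 := by decide
  exact this _ (leadingCoeff_ne_zero.2 hp)

lemma ideal_gen (m : ℕ) (I : Ideal (R2 m)) (hIJ : I ≤ Jm m) :
    ∃ g h : Polynomial (ZMod 2), fm m = g * h ∧ I = Ideal.span {mk2 m g} ∧ h ∣ geomPoly m := by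
  obtain ⟨g, hg⟩ := (IsPrincipalIdealRing.principal (I.comap (mk2 m))).1
  have hg' : I.comap (mk2 m) = Ideal.span {g} := hg
  have hI : I = Ideal.span {mk2 m g} := by
    rw [← Ideal.map_comap_of_surjective (mk2 m) (mk2_surj m) I, hg', Ideal.map_span,
      Set.image_singleton]
  have h1 : fm m ∈ I.comap (mk2 m) := by
    rw [Ideal.mem_comap, (mk2_eq_zero_iff m _).2 dvd_rfl]
    exact I.zero_mem
  rw [hg', Ideal.mem_span_singleton] at h1
  obtain ⟨h, hh⟩ := h1
  refine ⟨g, h, hh, hI, ?_⟩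
  have h2 : (X - 1) ∣ g := Jm_eval m g (hIJ (by rw [hI]; exact Ideal.mem_span_singleton_self _))
  obtain ⟨g', rfl⟩ := h2
  rw [fm_eq, mul_assoc] at hh
  have hX : (X - 1 : Polynomial (ZMod 2)) ≠ 0 := X_sub_C_ne_zero (1 : ZMod 2)
  exact Dvd.intro_left g' (mul_left_cancel₀ hX hh).symm

lemma geomPoly_ne_zero (m : ℕ) (hm : 0 < m) : geomPoly m ≠ 0 := by
  have h := (fm_monic m hm).ne_zero
  rw [fm_eq] at h
  exact right_ne_zero_of_mul h

lemma geomPoly_natDegree (m : ℕ) (hm : 0 < m) : (geomPoly m).natDegree = m - 1 := by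
  have h1 : (fm m).natDegree = m := natDegree_eq_of_degree_eq_some (fm_degree m hm)
  have hX : (X - 1 : Polynomial (ZMod 2)) ≠ 0 := X_sub_C_ne_zero (1 : ZMod 2)
  have hX1 : (X - 1 : Polynomial (ZMod 2)).natDegree = 1 := natDegree_X_sub_C (1 : ZMod 2)
  rw [fm_eq, natDegree_mul hX (geomPoly_ne_zero m hm), hX1] at h1
  omega

lemma ell_le (m : ℕ) (q : Polynomial (ZMod 2)) (hq : Irreducible q) (h : q ∣ geomPoly m) :
    ell m ≤ q.natDegree := Nat.sInf_le ⟨q, hq, h, rfl⟩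

lemma ell_pos (m : ℕ) (q : Polynomial (ZMod 2)) (hq : Irreducible q) (h : q ∣ geomPoly m) :
    0 < ell m := by
  obtain ⟨p, hp, _, hd⟩ : ell m ∈ {d | ∃ p : Polynomial (ZMod 2), Irreducible p ∧
    p ∣ geomPoly m ∧ p.natDegree = d} := Nat.sInf_mem ⟨_, q, hq, h, rfl⟩
  rw [← hd]
  exact hp.natDegree_pos

open scoped Pointwise in
lemma multiset_prod_mem_pow {M : Type*} [CommMonoid M] [DecidableEq M] (F : Finset M) (s : Multiset M) :
    ∀ K : ℕ, (∀ x ∈ s, x ∈ F) → s.card ≤ K → s.prod ∈ (insert 1 F) ^ K := by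
  induction s using Multiset.induction_on with
  | empty =>
    intro K _ _
    rw [Multiset.prod_zero]
    exact Finset.one_mem_pow (Finset.mem_insert_self _ _)
  | cons a s ih =>
    intro K hF hK
    rw [Multiset.card_cons] at hK
    obtain ⟨K, rfl⟩ : ∃ K', K = K' + 1 := ⟨K - 1, by omega⟩
    rw [Multiset.prod_cons, pow_succ']
    refine Finset.mul_mem_mul (Finset.mem_insert_of_mem (hF a (Multiset.mem_cons_self _ _))) ?_
    exact ih K (fun x hx => hF x (Multiset.mem_cons_of_mem hx)) (by omega)

lemma prod_nf (h : Polynomial (ZMod 2)) (h0 : h ≠ 0) :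
    (UniqueFactorizationMonoid.normalizedFactors h).prod = h := by
  rw [UniqueFactorizationMonoid.prod_normalizedFactors_eq h0,
    (monic_of_ne_zero2 h h0).normalize_eq_self]

lemma card_mul_le_natDegree (c : ℕ) (h : Polynomial (ZMod 2)) (h0 : h ≠ 0)
    (hc : ∀ q ∈ UniqueFactorizationMonoid.normalizedFactors h, c ≤ q.natDegree) :
    (UniqueFactorizationMonoid.normalizedFactors h).card * c ≤ h.natDegree := by
  have h1 : ((UniqueFactorizationMonoid.normalizedFactors h).map natDegree).sum = h.natDegree := by
    rw [← natDegree_multiset_prod _ (UniqueFactorizationMonoid.zero_notMem_normalizedFactors h),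
      prod_nf h h0]
  rw [← h1]
  have := Multiset.card_nsmul_le_sum
    (s := (UniqueFactorizationMonoid.normalizedFactors h).map natDegree) (a := c) (by simpa using hc)
  simpa using this

open scoped Pointwise in
lemma D_bound (m : ℕ) (hm : 0 < m) (j : ℕ) (D : Finset (Polynomial (ZMod 2)))
    (hD : ∀ h ∈ D, h ∣ geomPoly m ∧ h.natDegree = j) : D.card ≤ m ^ (j / ell m) := by
  classical
  set F := (UniqueFactorizationMonoid.normalizedFactors (geomPoly m)).toFinset with hF
  have hG := geomPoly_ne_zero m hm
  have hFc : F.card ≤ m - 1 := by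
    refine (Multiset.toFinset_card_le _).trans ?_
    rw [← geomPoly_natDegree m hm]
    simpa using card_mul_le_natDegree 1 (geomPoly m) hG (fun q hq =>
      (UniqueFactorizationMonoid.irreducible_of_normalized_factor q hq).natDegree_pos)
  have hsub : D ⊆ (insert 1 F) ^ (j / ell m) := by
    intro h hh
    obtain ⟨h1, h2⟩ := hD h hh
    have h0 : h ≠ 0 := ne_zero_of_dvd_ne_zero hG h1
    rw [← prod_nf h h0]
    apply multiset_prod_mem_pow
    · intro q hq
      rw [hF, Multiset.mem_toFinset]
      exact Multiset.mem_of_le ((UniqueFactorizationMonoid.dvd_iff_normalizedFactors_le_normalizedFactors h0 hG).1 h1) hq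
    · rcases Multiset.empty_or_exists_mem (UniqueFactorizationMonoid.normalizedFactors h)
        with he | ⟨q, hq⟩
      · rw [he]; simp
      · have hdv : ∀ q ∈ UniqueFactorizationMonoid.normalizedFactors h, q ∣ geomPoly m :=
          fun q hq => (UniqueFactorizationMonoid.dvd_of_mem_normalizedFactors hq).trans h1
        have hir : ∀ q ∈ UniqueFactorizationMonoid.normalizedFactors h, Irreducible q :=
          fun q hq => UniqueFactorizationMonoid.irreducible_of_normalized_factor q hq
        rw [Nat.le_div_iff_mul_le (ell_pos m q (hir q hq) (hdv q hq)), ← h2]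
        exact card_mul_le_natDegree _ h h0 fun q hq => ell_le m q (hir q hq) (hdv q hq)
  calc D.card ≤ ((insert 1 F) ^ (j / ell m)).card := Finset.card_le_card hsub
    _ ≤ (insert 1 F).card ^ (j / ell m) := Finset.card_pow_le
    _ ≤ m ^ (j / ell m) := by
      gcongr
      have := Finset.card_insert_le 1 F
      omega

lemma m_pow_le (m : ℕ) (hm : 0 < m) (j l : ℕ) :
    ((m ^ (j / l) : ℕ) : ℝ) ≤ (2 : ℝ) ^ (2 * (j : ℝ) * (Real.logb 2 m / l)) := by
  have hm1 : (1 : ℝ) ≤ m := by exact_mod_cast hm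
  have hL : 0 ≤ Real.logb 2 m := Real.logb_nonneg (by norm_num) hm1
  have h1 : (m : ℝ) = (2 : ℝ) ^ (Real.logb 2 m) :=
    (Real.rpow_logb (by norm_num) (by norm_num) (by linarith)).symm
  have h2 : ((j / l : ℕ) : ℝ) ≤ (j : ℝ) / l := Nat.cast_div_le
  have h3 : 0 ≤ (j : ℝ) / l := by positivity
  rw [Nat.cast_pow, ← Real.rpow_natCast]
  conv_lhs => rw [h1]
  rw [← Real.rpow_mul (by norm_num)]
  apply Real.rpow_le_rpow_of_exponent_le (by norm_num)
  calc Real.logb 2 m * ((j / l : ℕ) : ℝ) ≤ Real.logb 2 m * ((j : ℝ) / l) := by gcongr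
    _ ≤ 2 * (Real.logb 2 m * ((j : ℝ) / l)) := by linarith [mul_nonneg hL h3]
    _ = _ := by ring

lemma finite_divs (m : ℕ) (hm : 0 < m) (j : ℕ) :
    {h : Polynomial (ZMod 2) | h ∣ geomPoly m ∧ h.natDegree = j}.Finite := by
  have hf : ((degreeLT (ZMod 2) (j + 1) : Submodule _ _) : Set (Polynomial (ZMod 2))).Finite :=
    Set.finite_coe_iff.1 (finDegLT (j + 1))
  refine hf.subset fun h hh => ?_
  have h0 : h ≠ 0 := ne_zero_of_dvd_ne_zero (geomPoly_ne_zero m hm) hh.1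
  rw [SetLike.mem_coe, mem_degreeLT, degree_eq_natDegree h0, hh.2]
  exact_mod_cast Nat.lt_succ_self j

/-- The ideal with check polynomial `h`. -/
def Ih (m : ℕ) (h : Polynomial (ZMod 2)) : Ideal (R2 m) := Ideal.span {mk2 m (fm m / h)}

lemma Ih_le (m : ℕ) (hm : 0 < m) (h : Polynomial (ZMod 2)) (hh : h ∣ geomPoly m) :
    Ih m h ≤ Jm m ∧ fm m = (fm m / h) * h := by
  obtain ⟨k, hk⟩ := hh
  have h0 : h ≠ 0 := ne_zero_of_dvd_ne_zero (geomPoly_ne_zero m hm) ⟨k, hk⟩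
  have h1 : fm m = ((X - 1) * k) * h := by rw [fm_eq, hk]; ring
  have h2 : fm m / h = (X - 1) * k := by rw [h1]; exact mul_div_cancel_right₀ _ h0
  refine ⟨?_, by rw [h2]; exact h1⟩
  rw [Ih, h2, Ideal.span_singleton_le_iff_mem, map_mul]
  exact Ideal.mul_mem_right _ _ (Ideal.mem_span_singleton_self _)

/-- The number of pairs `(a,b) ∈ J_m × J_m` such that `C_{a,b}` has a
nonzero codeword of weight at most `3mδ` (i.e. there is `c ∈ J_m` with
`1 ≤ wt_H(c·a) + 2·wt_H(c·b) ≤ 3mδ`) is at most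
`2^{2(m-1)} · ∑_{j=ℓ_m}^{m-1} 2^{-2j(1/2 - H(3δ/2) - log₂m/ℓ_m)}`. -/
theorem statement9 (m : ℕ) (hm : Odd m) (hmpos : 0 < m)
    (δ : ℝ) (hδ0 : 0 < δ) (hδ1 : δ < 1/3) (hδ2 : Hent (3*δ/2) < 1/2) :
    (Nat.card {p : R2 m × R2 m // p.1 ∈ Jm m ∧ p.2 ∈ Jm m ∧
        ∃ c ∈ Jm m, 1 ≤ wt2 m (c * p.1) + 2 * wt2 m (c * p.2) ∧
          ((wt2 m (c * p.1) + 2 * wt2 m (c * p.2) : ℕ) : ℝ) ≤ 3 * m * δ} : ℝ)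
      ≤ (2 : ℝ) ^ (2 * ((m : ℝ) - 1)) *
        ∑ j ∈ Finset.Icc (ell m) (m - 1),
          (2 : ℝ) ^ (-2 * (j : ℝ) * (1/2 - Hent (3*δ/2) - Real.logb 2 m / (ell m : ℝ))) := by
  classical
  have := finite_R2 m hmpos
  have : Fintype (R2 m) := Fintype.ofFinite _
  choose e he hIe using exists_idem_gen m hm
  set D : ℕ → Finset (Polynomial (ZMod 2)) := fun j => (finite_divs m hmpos j).toFinset with hDdef
  have hD : ∀ j, ∀ h ∈ D j, h ∣ geomPoly m ∧ h.natDegree = j := by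
    intro j h hh
    simpa [hDdef] using hh
  set S : Polynomial (ZMod 2) → Finset (R2 m × R2 m) := fun h => Finset.univ.filter fun s =>
    s.1 ∈ Ih m h ∧ s.2 ∈ Ih m h ∧ ((wt2 m s.1 + wt2 m s.2 : ℕ) : ℝ) ≤ 2 * m * (3 * δ / 2) with hS
  set B : Polynomial (ZMod 2) → R2 m × R2 m → Finset (R2 m × R2 m) := fun h s =>
    Finset.univ.filter fun p => p.1 ∈ Jm m ∧ p.2 ∈ Jm m ∧
      ∃ d ∈ Ih m h, e (Ih m h) * p.1 = d * s.1 ∧ e (Ih m h) * p.2 = d * s.2 with hB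
  set U := (Finset.Icc (ell m) (m - 1)).biUnion fun j => (D j).biUnion fun h =>
    (S h).biUnion fun s => B h s with hU
  have hcover : Nat.card {p : R2 m × R2 m // p.1 ∈ Jm m ∧ p.2 ∈ Jm m ∧
        ∃ c ∈ Jm m, 1 ≤ wt2 m (c * p.1) + 2 * wt2 m (c * p.2) ∧
          ((wt2 m (c * p.1) + 2 * wt2 m (c * p.2) : ℕ) : ℝ) ≤ 3 * m * δ} ≤ U.card := by
    have hUn : Nat.card (U : Set (R2 m × R2 m)) = U.card := by simp
    rw [← hUn]
    refine Nat.card_mono (Set.toFinite _) ?_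
    rintro ⟨a, b⟩ ⟨ha, hb, c, hc, h1, h2⟩
    simp only at ha hb h1 h2
    set I : Ideal (R2 m) := Ideal.span {c * a, c * b} with hI
    have hu : c * a ∈ I := Ideal.subset_span (by simp)
    have hv : c * b ∈ I := Ideal.subset_span (by simp)
    have hIc : I ≤ Ideal.span {c} := by
      rw [hI, Ideal.span_le]
      rintro x (rfl | rfl)
      · exact Ideal.mul_mem_right _ _ (Ideal.mem_span_singleton_self _)
      · exact Ideal.mul_mem_right _ _ (Ideal.mem_span_singleton_self _)
    have hIJ : I ≤ Jm m := hIc.trans ((Ideal.span_singleton_le_iff_mem _).2 hc)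
    obtain ⟨g, h, hgh, hIg, hdiv⟩ := ideal_gen m I hIJ
    have h0 : h ≠ 0 := ne_zero_of_dvd_ne_zero (geomPoly_ne_zero m hmpos) hdiv
    have hIh : Ih m h = I := by
      have hq : fm m / h = g := by rw [hgh, mul_div_cancel_right₀ _ h0]
      rw [Ih, hIg, hq]
    have hnu : ¬ IsUnit h := by
      intro hun
      have hg0 : mk2 m g = 0 := by
        rw [mk2_eq_zero_iff, hgh]
        obtain ⟨w, hw⟩ := hun.exists_right_inv
        exact ⟨w, by rw [mul_assoc, hw, mul_one]⟩
      have hbot : ∀ x ∈ I, x = 0 := by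
        intro x hx
        rw [hIg, hg0] at hx
        simpa using hx
      rw [hbot _ hu, hbot _ hv] at h1
      simp [wt2, rep2_zero m hmpos] at h1
    obtain ⟨q, hq, hqh⟩ := WfDvdMonoid.exists_irreducible_factor hnu h0
    rw [hU]
    simp only [Finset.coe_biUnion, Set.mem_iUnion, Finset.mem_coe]
    refine ⟨h.natDegree, ?_, h, ?_, (c * a, c * b), ?_, ?_⟩
    · rw [Finset.mem_Icc]
      refine ⟨(ell_le m q hq (hqh.trans hdiv)).trans (natDegree_le_of_dvd hqh h0), ?_⟩
      rw [← geomPoly_natDegree m hmpos]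
      exact natDegree_le_of_dvd hdiv (geomPoly_ne_zero m hmpos)
    · simp [hDdef, hdiv]
    · rw [hS, Finset.mem_filter, hIh]
      refine ⟨Finset.mem_univ _, hu, hv, ?_⟩
      push_cast at h2 ⊢
      have : (0 : ℝ) ≤ wt2 m (c * b) := Nat.cast_nonneg _
      linarith
    · rw [hB, Finset.mem_filter, hIh]
      refine ⟨Finset.mem_univ _, ha, hb, ?_⟩
      obtain ⟨t, ht⟩ := Ideal.mem_span_singleton'.1 (hIc (he I))
      refine ⟨t * e I, Ideal.mul_mem_left _ _ (he I), ?_, ?_⟩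
      · simp only
        rw [mul_assoc, hIe I _ hu, ← mul_assoc, ht]
      · simp only
        rw [mul_assoc, hIe I _ hv, ← mul_assoc, ht]
  have hBc : ∀ j, ∀ h ∈ D j, ∀ s, ((B h s).card : ℝ) ≤
      (2 : ℝ) ^ (2 * ((m : ℝ) - 1)) * (2 : ℝ) ^ (-(j : ℝ)) := by
    intro j h hh s
    obtain ⟨h1, h2⟩ := hD j h hh
    obtain ⟨h3, h4⟩ := Ih_le m hmpos h h1
    have h5 := B_bound m hmpos (Ih m h) h3 _ (he _) (hIe _) s.1 s.2 (B h s) (by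
      intro p hp
      simpa [hB] using hp)
    have h6 : 2 ^ j ≤ Nat.card (Ih m h) := by
      rw [← h2]; exact card_I m hmpos _ h h4
    have h7 := card_Jm m hmpos
    have h8 : (B h s).card * 2 ^ j ≤ 2 ^ (m - 1) * 2 ^ (m - 1) := by
      have : Nat.card (B h s : Set (R2 m × R2 m)) = (B h s).card := by simp
      rw [this] at h5
      calc (B h s).card * 2 ^ j ≤ (B h s).card * Nat.card (Ih m h) := by gcongr
        _ ≤ _ := h5
        _ ≤ _ := by gcongr
    have h9 : ((B h s).card : ℝ) * 2 ^ j ≤ 2 ^ (m - 1) * 2 ^ (m - 1) := by exact_mod_cast h8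
    have h10 : (2 : ℝ) ^ (2 * ((m : ℝ) - 1)) = 2 ^ (m - 1) * 2 ^ (m - 1) := by
      rw [← pow_add, ← Real.rpow_natCast]
      congr 1
      push_cast [Nat.cast_sub (Nat.succ_le_of_lt hmpos)]
      ring
    rw [h10, Real.rpow_neg (by norm_num), Real.rpow_natCast, ← div_eq_mul_inv, le_div_iff₀ (by positivity)]
    exact h9
  have hSc : ∀ j ∈ Finset.Icc (ell m) (m - 1), ∀ h ∈ D j, ((S h).card : ℝ) ≤
      (2 : ℝ) ^ (2 * (j : ℝ) * Hent (3 * δ / 2)) := by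
    intro j hj h hh
    rw [Finset.mem_Icc] at hj
    obtain ⟨h1, h2⟩ := hD j h hh
    obtain ⟨h3, h4⟩ := Ih_le m hmpos h h1
    have hne : fm m / h * h ≠ 0 := by rw [← h4]; exact (fm_monic m hmpos).ne_zero
    refine S_bound m hmpos j (by omega) (fm m / h) ⟨h, h4⟩ ?_ (S h) _ (by linarith) (by linarith) ?_ ?_
    · have h5 : (fm m).natDegree = m := natDegree_eq_of_degree_eq_some (fm_degree m hmpos)
      have h6 := natDegree_mul (left_ne_zero_of_mul hne) (right_ne_zero_of_mul hne)
      rw [← h4, h5, h2] at h6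
      omega
    · intro s hs
      rw [hS, Finset.mem_filter] at hs
      exact ⟨hs.2.1, hs.2.2.1⟩
    · intro s hs
      rw [hS, Finset.mem_filter] at hs
      exact hs.2.2.2
  have hUc : (U.card : ℝ) ≤ ∑ j ∈ Finset.Icc (ell m) (m - 1), ∑ h ∈ D j, ∑ s ∈ S h,
      ((B h s).card : ℝ) := by
    have : U.card ≤ ∑ j ∈ Finset.Icc (ell m) (m - 1), ∑ h ∈ D j, ∑ s ∈ S h, (B h s).card := by
      refine Finset.card_biUnion_le.trans (Finset.sum_le_sum fun j _ => ?_)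
      refine Finset.card_biUnion_le.trans (Finset.sum_le_sum fun h _ => ?_)
      exact Finset.card_biUnion_le
    exact_mod_cast this
  refine (Nat.cast_le.2 hcover).trans (hUc.trans ?_)
  rw [Finset.mul_sum]
  refine Finset.sum_le_sum fun j hj => ?_
  set A := (2 : ℝ) ^ (2 * ((m : ℝ) - 1)) with hA
  have hA0 : 0 ≤ A := by positivity
  calc ∑ h ∈ D j, ∑ s ∈ S h, ((B h s).card : ℝ)
      ≤ ∑ h ∈ D j, (2 : ℝ) ^ (2 * (j : ℝ) * Hent (3 * δ / 2)) * (A * (2 : ℝ) ^ (-(j : ℝ))) := by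
        refine Finset.sum_le_sum fun h hh => ?_
        refine (Finset.sum_le_sum fun s _ => hBc j h hh s).trans ?_
        rw [Finset.sum_const, nsmul_eq_mul]
        exact mul_le_mul_of_nonneg_right (hSc j hj h hh) (by positivity)
    _ = ((D j).card : ℝ) * ((2 : ℝ) ^ (2 * (j : ℝ) * Hent (3 * δ / 2)) *
          (A * (2 : ℝ) ^ (-(j : ℝ)))) := by rw [Finset.sum_const, nsmul_eq_mul]
    _ ≤ (2 : ℝ) ^ (2 * (j : ℝ) * (Real.logb 2 m / ell m)) *
          ((2 : ℝ) ^ (2 * (j : ℝ) * Hent (3 * δ / 2)) * (A * (2 : ℝ) ^ (-(j : ℝ)))) := by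
        refine mul_le_mul_of_nonneg_right ?_ (by positivity)
        exact (Nat.cast_le.2 (D_bound m hmpos j (D j) (hD j))).trans (m_pow_le m hmpos j (ell m))
    _ = A * ((2 : ℝ) ^ (2 * (j : ℝ) * (Real.logb 2 m / ell m)) *
          (2 : ℝ) ^ (2 * (j : ℝ) * Hent (3 * δ / 2)) * (2 : ℝ) ^ (-(j : ℝ))) := by ring
    _ = _ := by
        rw [← Real.rpow_add (by norm_num), ← Real.rpow_add (by norm_num)]
        congr 2
        ring

end
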